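/- There exists a constant b > 1, depending only on B, such that for all f₁, f₂ with Fourier coefficient sequences θ₁, θ₂ in D = {θ : ∑_{j≥1} |θ_j| < B} (with θ_{i,1} = 0, so that ∫ f_i = 0): D(P_{f₁}, P_{f₂}) ≤ b ‖θ₁ − θ₂‖², V(P_{f₁}, P_{f₂}) ≤ b ‖θ₁ − θ₂‖², and b^{−1} H(P_{f₁}, P_{f₂}) ≤ ‖θ₁ − θ₂‖ ≤ b H(P_{f₁}, P_{f₂}). -/

import Mathlib

open MeasureTheory Real

noncomputable section

/-- The trigonometric orthonormal basis of `L²[0,1]` (0-based indexing: `phiTrig 0 = 1`,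
`phiTrig (2m−1) = √2 cos(2πm·)`, `phiTrig (2m) = √2 sin(2πm·)`). -/
def phiTrig (j : ℕ) (t : ℝ) : ℝ :=
  if j = 0 then 1
  else if j % 2 = 1 then Real.sqrt 2 * Real.cos (2 * π * (((j + 1) / 2 : ℕ) : ℝ) * t)
  else Real.sqrt 2 * Real.sin (2 * π * ((j / 2 : ℕ) : ℝ) * t)

/-- The function `f = ∑_j θ_j φ_j` with coefficient sequence `θ`. -/
def seriesFun (θ : ℕ → ℝ) (t : ℝ) : ℝ := ∑' j : ℕ, θ j * phiTrig j t

/-- The density `p_f(t) = e^{f(t)} / ∫₀¹ e^{f}` of the density-estimation model. -/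
def densityF (θ : ℕ → ℝ) (t : ℝ) : ℝ :=
  Real.exp (seriesFun θ t) / ∫ s in Set.Icc (0 : ℝ) 1, Real.exp (seriesFun θ s)

/-- Kullback–Leibler divergence `D(P_{f₁}, P_{f₂}) = ∫ p_{f₁} log(p_{f₁}/p_{f₂})`. -/
def KLdiv (θ₁ θ₂ : ℕ → ℝ) : ℝ :=
  ∫ t in Set.Icc (0 : ℝ) 1, densityF θ₁ t * Real.log (densityF θ₁ t / densityF θ₂ t)

/-- The divergence `V(P_{f₁}, P_{f₂}) = ∫ p_{f₁} (log(p_{f₁}/p_{f₂}) − D(P_{f₁},P_{f₂}))²`. -/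
def Vdiv (θ₁ θ₂ : ℕ → ℝ) : ℝ :=
  ∫ t in Set.Icc (0 : ℝ) 1,
    densityF θ₁ t * (Real.log (densityF θ₁ t / densityF θ₂ t) - KLdiv θ₁ θ₂) ^ 2

/-- Hellinger distance `H(P_{f₁}, P_{f₂}) = (∫ (√p_{f₁} − √p_{f₂})²)^{1/2}`. -/
def Hdist (θ₁ θ₂ : ℕ → ℝ) : ℝ :=
  Real.sqrt (∫ t in Set.Icc (0 : ℝ) 1,
    (Real.sqrt (densityF θ₁ t) - Real.sqrt (densityF θ₂ t)) ^ 2)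

/-- The `ℓ¹`-constraint set `D = {θ : ∑_j |θ_j| < B}`. -/
def absBall (B : ℝ) : Set (ℕ → ℝ) :=
  {θ | (Summable fun j : ℕ => |θ j|) ∧ ∑' j : ℕ, |θ j| < B}

/-- Squared `ℓ²` distance between coefficient sequences. -/
def l2sq (θ₁ θ₂ : ℕ → ℝ) : ℝ := ∑' j : ℕ, (θ₁ j - θ₂ j) ^ 2


lemma int_cos_aux (n : ℤ) : ∫ t in (0:ℝ)..1, Real.cos (2 * π * n * t) = if n = 0 then 1 else 0 := by
  split_ifs with h
  · simp [h]
  · have : (2 * π * n : ℝ) ≠ 0 := by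
      have : (n:ℝ) ≠ 0 := by exact_mod_cast h
      positivity
    rw [intervalIntegral.integral_comp_mul_left _ this]
    simp only [integral_cos, mul_zero, mul_one, Real.sin_zero, sub_zero]
    have := Real.sin_int_mul_pi (2 * n)
    push_cast at this
    rw [show 2 * π * (n:ℝ) = 2 * n * π by ring, this]; simp

lemma int_sin_aux (n : ℤ) : ∫ t in (0:ℝ)..1, Real.sin (2 * π * n * t) = 0 := by
  by_cases h : n = 0
  · simp [h]
  · have : (2 * π * n : ℝ) ≠ 0 := by
      have : (n:ℝ) ≠ 0 := by exact_mod_cast h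
      positivity
    rw [intervalIntegral.integral_comp_mul_left _ this]
    simp only [integral_sin, mul_zero, mul_one, Real.cos_zero]
    have := Real.cos_int_mul_two_pi n
    rw [show 2 * π * (n:ℝ) = n * (2 * π) by ring, this]; simp

lemma int_cc (m n : ℕ) (hm : 0 < m) : ∫ t in (0:ℝ)..1,
    (√2 * Real.cos (2 * π * m * t)) * (√2 * Real.cos (2 * π * n * t)) = if m = n then 1 else 0 := by
  have e : ∀ t : ℝ, (√2 * Real.cos (2 * π * m * t)) * (√2 * Real.cos (2 * π * n * t))
      = Real.cos (2 * π * ((m - n : ℤ) : ℝ) * t) + Real.cos (2 * π * ((m + n : ℤ) : ℝ) * t) := by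
    intro t
    push_cast
    rw [show 2 * π * ((m:ℝ) - n) * t = 2 * π * m * t - 2 * π * n * t by ring,
      show 2 * π * ((m:ℝ) + n) * t = 2 * π * m * t + 2 * π * n * t by ring, Real.cos_sub, Real.cos_add]
    have := Real.mul_self_sqrt (show (0:ℝ) ≤ 2 by norm_num)
    linear_combination (Real.cos (2 * π * m * t) * Real.cos (2 * π * n * t)) * this
  simp_rw [e]
  rw [intervalIntegral.integral_add (by apply Continuous.intervalIntegrable; fun_prop)
    (by apply Continuous.intervalIntegrable; fun_prop), int_cos_aux, int_cos_aux]
  rw [if_neg (show ¬ ((m:ℤ) + n = 0) by omega)]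
  by_cases h : m = n
  · simp [h]
  · rw [if_neg h, if_neg (by omega)]; simp

lemma int_ss (m n : ℕ) (hm : 0 < m) : ∫ t in (0:ℝ)..1,
    (√2 * Real.sin (2 * π * m * t)) * (√2 * Real.sin (2 * π * n * t)) = if m = n then 1 else 0 := by
  have e : ∀ t : ℝ, (√2 * Real.sin (2 * π * m * t)) * (√2 * Real.sin (2 * π * n * t))
      = Real.cos (2 * π * ((m - n : ℤ) : ℝ) * t) - Real.cos (2 * π * ((m + n : ℤ) : ℝ) * t) := by
    intro t
    push_cast
    rw [show 2 * π * ((m:ℝ) - n) * t = 2 * π * m * t - 2 * π * n * t by ring,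
      show 2 * π * ((m:ℝ) + n) * t = 2 * π * m * t + 2 * π * n * t by ring, Real.cos_sub, Real.cos_add]
    have := Real.mul_self_sqrt (show (0:ℝ) ≤ 2 by norm_num)
    linear_combination (Real.sin (2 * π * m * t) * Real.sin (2 * π * n * t)) * this
  simp_rw [e]
  rw [intervalIntegral.integral_sub (by apply Continuous.intervalIntegrable; fun_prop)
    (by apply Continuous.intervalIntegrable; fun_prop), int_cos_aux, int_cos_aux]
  rw [if_neg (show ¬ ((m:ℤ) + n = 0) by omega)]
  by_cases h : m = n
  · simp [h]
  · rw [if_neg h, if_neg (by omega)]; simp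

lemma int_sc (m n : ℕ) : ∫ t in (0:ℝ)..1,
    (√2 * Real.sin (2 * π * m * t)) * (√2 * Real.cos (2 * π * n * t)) = 0 := by
  have e : ∀ t : ℝ, (√2 * Real.sin (2 * π * m * t)) * (√2 * Real.cos (2 * π * n * t))
      = Real.sin (2 * π * ((m - n : ℤ) : ℝ) * t) + Real.sin (2 * π * ((m + n : ℤ) : ℝ) * t) := by
    intro t
    push_cast
    rw [show 2 * π * ((m:ℝ) - n) * t = 2 * π * m * t - 2 * π * n * t by ring,
      show 2 * π * ((m:ℝ) + n) * t = 2 * π * m * t + 2 * π * n * t by ring, Real.sin_sub, Real.sin_add]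
    have := Real.mul_self_sqrt (show (0:ℝ) ≤ 2 by norm_num)
    linear_combination (Real.sin (2 * π * m * t) * Real.cos (2 * π * n * t)) * this
  simp_rw [e]
  rw [intervalIntegral.integral_add (by apply Continuous.intervalIntegrable; fun_prop)
    (by apply Continuous.intervalIntegrable; fun_prop), int_sin_aux, int_sin_aux]
  simp

lemma phi_cont (j : ℕ) : Continuous (phiTrig j) := by
  unfold phiTrig
  split_ifs <;> fun_prop

lemma phi_bound (j : ℕ) (t : ℝ) : |phiTrig j t| ≤ 2 := by
  have h2 : √2 ≤ 2 := by
    rw [Real.sqrt_le_left (by norm_num)]; norm_num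
  unfold phiTrig
  split_ifs
  · norm_num
  · rw [abs_mul, abs_of_nonneg (Real.sqrt_nonneg _)]
    nlinarith [Real.abs_cos_le_one (2 * π * (((j + 1) / 2 : ℕ) : ℝ) * t), Real.sqrt_nonneg 2, abs_nonneg (Real.cos (2 * π * (((j + 1) / 2 : ℕ) : ℝ) * t))]
  · rw [abs_mul, abs_of_nonneg (Real.sqrt_nonneg _)]
    nlinarith [Real.abs_sin_le_one (2 * π * ((j / 2 : ℕ) : ℝ) * t), Real.sqrt_nonneg 2, abs_nonneg (Real.sin (2 * π * ((j / 2 : ℕ) : ℝ) * t))]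

lemma phi_zero_int (j : ℕ) : ∫ t in (0:ℝ)..1, phiTrig j t = if j = 0 then 1 else 0 := by
  unfold phiTrig
  split_ifs with h h'
  · simp
  · rw [intervalIntegral.integral_const_mul]
    have := int_cos_aux (((j+1)/2 : ℕ) : ℤ)
    rw [if_neg (by omega)] at this
    rw [Int.cast_natCast] at this
    rw [this, mul_zero]
  · rw [intervalIntegral.integral_const_mul]
    have := int_sin_aux ((j/2 : ℕ) : ℤ)
    rw [Int.cast_natCast] at this
    rw [this, mul_zero]

lemma phi_orth (j k : ℕ) : ∫ t in (0:ℝ)..1, phiTrig j t * phiTrig k t = if j = k then 1 else 0 := by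
  by_cases hj : j = 0
  · subst hj
    have := phi_zero_int k
    simp only [phiTrig, if_true, one_mul] at this ⊢
    rw [this]; simp [eq_comm]
  by_cases hk : k = 0
  · subst hk
    have := phi_zero_int j
    simp only [phiTrig, if_true, mul_one] at this ⊢
    rw [this]
  unfold phiTrig
  simp only [hj, hk, if_false]
  by_cases h1 : j % 2 = 1 <;> by_cases h2 : k % 2 = 1 <;> simp only [h1, h2, if_true, if_false]
  · rw [int_cc _ _ (by omega)]
    congr 1
    apply propext; omega
  · rw [if_neg (by rintro rfl; exact h2 h1)]
    refine Eq.trans ?_ (int_sc (k/2) ((j+1)/2))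
    congr 1; ext t; ring
  · rw [if_neg (by rintro rfl; exact h1 h2)]
    exact int_sc _ _
  · rw [int_ss _ _ (by omega)]
    congr 1
    apply propext; omega

abbrev mu01 : Measure ℝ := volume.restrict (Set.Icc (0:ℝ) 1)

lemma mu_int (h : ℝ → ℝ) : ∫ t, h t ∂mu01 = ∫ t in (0:ℝ)..1, h t := by
  rw [intervalIntegral.integral_of_le zero_le_one, integral_Icc_eq_integral_Ioc]

instance : IsProbabilityMeasure mu01 := ⟨by simp [mu01]⟩

lemma mu_integrable {h : ℝ → ℝ} (hh : Continuous h) : Integrable h mu01 :=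
  hh.continuousOn.integrableOn_compact isCompact_Icc

lemma term_bound (θ : ℕ → ℝ) (j : ℕ) (t : ℝ) : ‖θ j * phiTrig j t‖ ≤ 2 * |θ j| := by
  rw [norm_mul, Real.norm_eq_abs, Real.norm_eq_abs]
  nlinarith [phi_bound j t, abs_nonneg (θ j)]

lemma term_summable {θ : ℕ → ℝ} (h : Summable fun j => |θ j|) (t : ℝ) :
    Summable fun j => θ j * phiTrig j t :=
  Summable.of_norm_bounded (h.mul_left 2) (fun j => term_bound θ j t)

lemma series_cont {θ : ℕ → ℝ} (h : Summable fun j => |θ j|) : Continuous (seriesFun θ) :=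
  continuous_tsum (fun j => continuous_const.mul (phi_cont j)) (h.mul_left 2)
    (fun j t => term_bound θ j t)

lemma series_bound {θ : ℕ → ℝ} (h : Summable fun j => |θ j|) (t : ℝ) :
    |seriesFun θ t| ≤ 2 * ∑' j, |θ j| := by
  rw [← Real.norm_eq_abs, ← tsum_mul_left]
  exact tsum_of_norm_bounded (h.mul_left 2).hasSum (fun j => term_bound θ j t)

lemma series_int {θ : ℕ → ℝ} (h : Summable fun j => |θ j|) {g : ℝ → ℝ} (hg : Continuous g) 
    {C : ℝ} (hC : ∀ t, |g t| ≤ C) :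
    HasSum (fun j => θ j * ∫ t, phiTrig j t * g t ∂mu01) (∫ t, seriesFun θ t * g t ∂mu01) := by
  have := hasSum_integral_of_summable_integral_norm (μ := mu01)
    (F := fun j t => θ j * (phiTrig j t * g t)) 
    (fun j => mu_integrable (by have := phi_cont j; fun_prop)) ?_
  · simp only [integral_const_mul] at this
    have e : ∀ t, seriesFun θ t * g t = ∑' j, θ j * (phiTrig j t * g t) := by
      intro t
      unfold seriesFun
      rw [← tsum_mul_right]
      simp only [mul_assoc]
    simp only [e]
    exact this
  · refine Summable.of_nonneg_of_le (fun j => integral_nonneg fun t => norm_nonneg _) (fun j => ?_)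
      (h.mul_left (2 * C))
    calc _ ≤ ∫ t, 2 * C * |θ j| ∂mu01 := by
          apply integral_mono (mu_integrable (by have := phi_cont j; fun_prop)) (integrable_const _)
          intro t
          simp only
          rw [← mul_assoc, norm_mul]
          have h1 := term_bound θ j t
          have h2 := hC t
          rw [← Real.norm_eq_abs] at h2
          calc _ ≤ (2 * |θ j|) * C := by gcongr
            _ = _ := by ring
      _ = _ := by simp

lemma series_mean {θ : ℕ → ℝ} (h : Summable fun j => |θ j|) : ∫ t, seriesFun θ t ∂mu01 = θ 0 := by
  have := series_int h (g := fun _ => 1) continuous_const (C := 1) (by simp)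
  simp only [mul_one, mu_int, phi_zero_int] at this
  rw [mu_int, ← this.tsum_eq]
  simp

lemma series_coef {θ : ℕ → ℝ} (h : Summable fun j => |θ j|) (k : ℕ) :
    ∫ t, phiTrig k t * seriesFun θ t ∂mu01 = θ k := by
  have := series_int h (phi_cont k) (phi_bound k)
  simp only [mu_int, phi_orth] at this
  simp only [mul_comm (phiTrig k _)]
  rw [mu_int, ← this.tsum_eq]
  simp

lemma series_parseval {θ : ℕ → ℝ} (h : Summable fun j => |θ j|) :
    ∫ t, seriesFun θ t ^ 2 ∂mu01 = ∑' j, θ j ^ 2 := by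
  have := series_int h (series_cont h) (series_bound h)
  simp only [series_coef h] at this
  simp only [pow_two]
  exact this.tsum_eq.symm

lemma exp_lip {a b K : ℝ} (ha : a ≤ K) (hb : b ≤ K) :
    |Real.exp a - Real.exp b| ≤ Real.exp K * |a - b| := by
  wlog h : b ≤ a generalizing a b
  · rw [abs_sub_comm, abs_sub_comm a]; exact this hb ha (by linarith)
  have h1 := Real.exp_le_exp.2 h
  rw [abs_of_nonneg (by linarith), abs_of_nonneg (by linarith)]
  have h2 := Real.add_one_le_exp (b - a)
  have h3 : Real.exp b = Real.exp a * Real.exp (b - a) := by rw [← Real.exp_add]; ring_nf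
  have h4 := Real.exp_le_exp.2 ha
  have h5 := Real.exp_pos a
  calc _ ≤ Real.exp a * (a - b) := by rw [h3]; nlinarith
    _ ≤ _ := by apply mul_le_mul_of_nonneg_right h4; linarith

lemma exp_lip_lower {a b K : ℝ} (ha : -K ≤ a) (hb : -K ≤ b) :
    |a - b| ≤ Real.exp K * |Real.exp a - Real.exp b| := by
  wlog h : b ≤ a generalizing a b
  · rw [abs_sub_comm, abs_sub_comm (Real.exp a)]; exact this hb ha (by linarith)
  have h1 := Real.exp_le_exp.2 h
  rw [abs_of_nonneg (by linarith), abs_of_nonneg (by linarith)]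
  have h2 := Real.add_one_le_exp (a - b)
  have h3 : Real.exp a = Real.exp b * Real.exp (a - b) := by rw [← Real.exp_add]; ring_nf
  have h4 : 1 ≤ Real.exp K * Real.exp b := by rw [← Real.exp_add]; apply Real.one_le_exp; linarith
  calc a - b ≤ (Real.exp K * Real.exp b) * (a - b) := by nlinarith
    _ ≤ (Real.exp K * Real.exp b) * (Real.exp (a - b) - 1) := by
      apply mul_le_mul_of_nonneg_left _ (by positivity); linarith
    _ = _ := by rw [h3]; ring

/-- The abstract comparison for two normalized log-densities. -/
lemma abstract_bounds {g₁ g₂ : ℝ → ℝ} (h1 : Continuous g₁) (h2 : Continuous g₂) {K : ℝ}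
    (b1 : ∀ t, |g₁ t| ≤ K) (b2 : ∀ t, |g₂ t| ≤ K)
    (n1 : ∫ t, Real.exp (g₁ t) ∂mu01 = 1) (n2 : ∫ t, Real.exp (g₂ t) ∂mu01 = 1) :
    (∫ t, Real.exp (g₁ t) * (g₁ t - g₂ t) ∂mu01 ≤ Real.exp K * ∫ t, (g₁ t - g₂ t) ^ 2 ∂mu01) ∧
    (∫ t, Real.exp (g₁ t) * (g₁ t - g₂ t - ∫ t, Real.exp (g₁ t) * (g₁ t - g₂ t) ∂mu01) ^ 2 ∂mu01
      ≤ Real.exp K * ∫ t, (g₁ t - g₂ t) ^ 2 ∂mu01) ∧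
    (∫ t, (Real.exp (g₁ t / 2) - Real.exp (g₂ t / 2)) ^ 2 ∂mu01
      ≤ Real.exp K * ∫ t, (g₁ t - g₂ t) ^ 2 ∂mu01) ∧
    (∫ t, (g₁ t - g₂ t) ^ 2 ∂mu01
      ≤ 4 * Real.exp K * ∫ t, (Real.exp (g₁ t / 2) - Real.exp (g₂ t / 2)) ^ 2 ∂mu01) := by
  have hsq : Real.exp (K / 2) ^ 2 = Real.exp K := by rw [← Real.exp_nat_mul]; ring_nf
  refine ⟨?_, ?_, ?_, ?_⟩
  · have e1 : ∫ t, (Real.exp (g₁ t) - Real.exp (g₂ t)) ∂mu01 = 0 := by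
      rw [integral_sub (mu_integrable (by fun_prop)) (mu_integrable (by fun_prop)), n1, n2, sub_self]
    have : ∫ t, Real.exp (g₁ t) * (g₁ t - g₂ t) ∂mu01 ≤
        ∫ t, (Real.exp K * (g₁ t - g₂ t) ^ 2 + (Real.exp (g₁ t) - Real.exp (g₂ t))) ∂mu01 := by
      apply integral_mono (mu_integrable (by fun_prop)) (mu_integrable (by fun_prop))
      intro t
      simp only
      have a1 := exp_lip (le_of_abs_le (b1 t)) (le_of_abs_le (b2 t))
      have a2 := Real.add_one_le_exp (g₁ t - g₂ t)
      have a3 : Real.exp (g₁ t) = Real.exp (g₂ t) * Real.exp (g₁ t - g₂ t) := by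
        rw [← Real.exp_add]; ring_nf
      have a4 : Real.exp (g₂ t) * (g₁ t - g₂ t) ≤ Real.exp (g₁ t) - Real.exp (g₂ t) := by
        rw [a3]; nlinarith [Real.exp_pos (g₂ t)]
      have a5 : (Real.exp (g₁ t) - Real.exp (g₂ t)) * (g₁ t - g₂ t)
          ≤ Real.exp K * (g₁ t - g₂ t) ^ 2 := by
        calc _ ≤ |(Real.exp (g₁ t) - Real.exp (g₂ t)) * (g₁ t - g₂ t)| := le_abs_self _
          _ = |Real.exp (g₁ t) - Real.exp (g₂ t)| * |g₁ t - g₂ t| := abs_mul _ _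
          _ ≤ (Real.exp K * |g₁ t - g₂ t|) * |g₁ t - g₂ t| := by gcongr
          _ = _ := by rw [mul_assoc, abs_mul_abs_self, pow_two]
      linarith
    rw [integral_add (mu_integrable (by fun_prop)) (mu_integrable (by fun_prop)), e1,
      integral_const_mul, add_zero] at this
    exact this
  · set k := ∫ t, Real.exp (g₁ t) * (g₁ t - g₂ t) ∂mu01 with hk
    have e : ∫ t, Real.exp (g₁ t) * (g₁ t - g₂ t - k) ^ 2 ∂mu01
        = ∫ t, Real.exp (g₁ t) * (g₁ t - g₂ t) ^ 2 ∂mu01 - k ^ 2 := by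
      have : ∀ t, Real.exp (g₁ t) * (g₁ t - g₂ t - k) ^ 2 = Real.exp (g₁ t) * (g₁ t - g₂ t) ^ 2
          - (2 * k) * (Real.exp (g₁ t) * (g₁ t - g₂ t)) + k ^ 2 * Real.exp (g₁ t) := by
        intro t; ring
      simp_rw [this]
      rw [integral_add (mu_integrable (by fun_prop)) (mu_integrable (by fun_prop)),
        integral_sub (mu_integrable (by fun_prop)) (mu_integrable (by fun_prop)),
        integral_const_mul, integral_const_mul, n1, ← hk]
      ring
    rw [e]
    have : ∫ t, Real.exp (g₁ t) * (g₁ t - g₂ t) ^ 2 ∂mu01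
        ≤ ∫ t, Real.exp K * (g₁ t - g₂ t) ^ 2 ∂mu01 := by
      apply integral_mono (mu_integrable (by fun_prop)) (mu_integrable (by fun_prop))
      intro t
      simp only
      gcongr
      exact le_of_abs_le (b1 t)
    rw [integral_const_mul] at this
    nlinarith [sq_nonneg k]
  · rw [← integral_const_mul]
    apply integral_mono (mu_integrable (by fun_prop)) (mu_integrable (by fun_prop))
    intro t
    simp only
    have l1 := le_of_abs_le (b1 t)
    have l2 := le_of_abs_le (b2 t)
    have a1 := exp_lip (a := g₁ t / 2) (b := g₂ t / 2) (K := K / 2) (by linarith) (by linarith)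
    have a2 := pow_le_pow_left₀ (abs_nonneg _) a1 2
    rw [mul_pow, sq_abs, sq_abs, hsq] at a2
    nlinarith [mul_nonneg (Real.exp_pos K).le (sq_nonneg (g₁ t - g₂ t))]
  · rw [← integral_const_mul]
    apply integral_mono (mu_integrable (by fun_prop)) (mu_integrable (by fun_prop))
    intro t
    simp only
    have l1 := neg_le_of_abs_le (b1 t)
    have l2 := neg_le_of_abs_le (b2 t)
    have a1 := exp_lip_lower (a := g₁ t / 2) (b := g₂ t / 2) (K := K / 2) (by linarith) (by linarith)
    have a2 := pow_le_pow_left₀ (abs_nonneg _) a1 2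
    rw [mul_pow, sq_abs, sq_abs, hsq] at a2
    nlinarith

/-- Log-normalizer. -/
def logZ (f : ℝ → ℝ) : ℝ := Real.log (∫ t, Real.exp (f t) ∂mu01)

lemma Z_bounds {f : ℝ → ℝ} (hf : Continuous f) {M : ℝ} (b : ∀ t, |f t| ≤ M) :
    Real.exp (-M) ≤ ∫ t, Real.exp (f t) ∂mu01 ∧ ∫ t, Real.exp (f t) ∂mu01 ≤ Real.exp M := by
  constructor
  · have := integral_mono (μ := mu01) (integrable_const (Real.exp (-M)))
      (mu_integrable (h := fun t => Real.exp (f t)) (by fun_prop))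
      (fun t => Real.exp_le_exp.2 (neg_le_of_abs_le (b t)))
    simpa using this
  · have := integral_mono (μ := mu01) 
      (mu_integrable (h := fun t => Real.exp (f t)) (by fun_prop)) (integrable_const (Real.exp M))
      (fun t => Real.exp_le_exp.2 (le_of_abs_le (b t)))
    simpa using this

lemma exp_logZ {f : ℝ → ℝ} (hf : Continuous f) {M : ℝ} (b : ∀ t, |f t| ≤ M) :
    Real.exp (logZ f) = ∫ t, Real.exp (f t) ∂mu01 :=
  Real.exp_log (lt_of_lt_of_le (Real.exp_pos _) (Z_bounds hf b).1)

lemma logZ_bound {f : ℝ → ℝ} (hf : Continuous f) {M : ℝ} (b : ∀ t, |f t| ≤ M) :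
    |logZ f| ≤ M := by
  have h := Z_bounds hf b
  rw [← exp_logZ hf b, Real.exp_le_exp, Real.exp_le_exp] at h
  exact abs_le.2 h

lemma logZ_diff {f₁ f₂ : ℝ → ℝ} (h1 : Continuous f₁) (h2 : Continuous f₂) {M : ℝ}
    (b1 : ∀ t, |f₁ t| ≤ M) (b2 : ∀ t, |f₂ t| ≤ M) :
    (logZ f₁ - logZ f₂) ^ 2 ≤ Real.exp (4 * M) * ∫ t, (f₁ t - f₂ t) ^ 2 ∂mu01 := by
  have a1 := exp_lip_lower (neg_le_of_abs_le (logZ_bound h1 b1)) (neg_le_of_abs_le (logZ_bound h2 b2))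
  rw [exp_logZ h1 b1, exp_logZ h2 b2, ← integral_sub (mu_integrable (by fun_prop))
    (mu_integrable (by fun_prop))] at a1
  have a2 : |∫ t, (Real.exp (f₁ t) - Real.exp (f₂ t)) ∂mu01|
      ≤ Real.exp M * ∫ t, |f₁ t - f₂ t| ∂mu01 := by
    rw [← integral_const_mul]
    refine (abs_integral_le_integral_abs).trans ?_
    apply integral_mono (mu_integrable (by fun_prop)) (mu_integrable (by fun_prop))
    intro t
    exact exp_lip (le_of_abs_le (b1 t)) (le_of_abs_le (b2 t))
  have a3 : (∫ t, |f₁ t - f₂ t| ∂mu01) ^ 2 ≤ ∫ t, (f₁ t - f₂ t) ^ 2 ∂mu01 := by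
    set k := ∫ t, |f₁ t - f₂ t| ∂mu01 with hk
    have : 0 ≤ ∫ t, (|f₁ t - f₂ t| - k) ^ 2 ∂mu01 := integral_nonneg fun t => sq_nonneg _
    have e : ∀ t, (|f₁ t - f₂ t| - k) ^ 2 = (f₁ t - f₂ t) ^ 2 - 2 * k * |f₁ t - f₂ t| + k ^ 2 := by
      intro t; rw [sub_sq, sq_abs]; ring
    simp_rw [e] at this
    rw [integral_add (mu_integrable (by fun_prop)) (mu_integrable (by fun_prop)),
        integral_sub (mu_integrable (by fun_prop)) (mu_integrable (by fun_prop)),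
        integral_const_mul, ← hk] at this
    simp at this
    nlinarith
  have a4 := a1.trans (mul_le_mul_of_nonneg_left a2 (Real.exp_pos M).le)
  rw [← mul_assoc] at a4
  have a5 := pow_le_pow_left₀ (abs_nonneg _) a4 2
  rw [sq_abs, mul_pow] at a5
  have e : (Real.exp M * Real.exp M) ^ 2 = Real.exp (4 * M) := by
    rw [← Real.exp_add, ← Real.exp_nat_mul]; ring_nf
  rw [e] at a5
  exact a5.trans (mul_le_mul_of_nonneg_left a3 (Real.exp_pos _).le)

lemma density_eq {θ : ℕ → ℝ} (h : Summable fun j => |θ j|) (t : ℝ) :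
    densityF θ t = Real.exp (seriesFun θ t - logZ (seriesFun θ)) := by
  rw [Real.exp_sub, exp_logZ (series_cont h) (series_bound h)]
  rfl

/-- **Lemma 3.2**: on the constraint set `D` (with the identifiability convention
`θ₁ = 0`, i.e. zero first coefficient), the divergences `D`, `V` and the Hellinger
distance of the density-estimation model are equivalent to the `ℓ²` norm of the
coefficients, with a constant depending only on `B`. -/
theorem density_divergence_equivalence (B : ℝ) (hB : 0 < B) :
    ∃ b > 1, ∀ θ₁ ∈ absBall B, ∀ θ₂ ∈ absBall B, θ₁ 0 = 0 → θ₂ 0 = 0 →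
      KLdiv θ₁ θ₂ ≤ b * l2sq θ₁ θ₂ ∧
      Vdiv θ₁ θ₂ ≤ b * l2sq θ₁ θ₂ ∧
      b⁻¹ * Hdist θ₁ θ₂ ≤ Real.sqrt (l2sq θ₁ θ₂) ∧
      Real.sqrt (l2sq θ₁ θ₂) ≤ b * Hdist θ₁ θ₂ := by
  set M := 2 * B with hM
  set b := 1 + 4 * Real.exp (2 * M) * (1 + Real.exp (4 * M)) with hb
  have hpos : 0 < 4 * Real.exp (2 * M) * (1 + Real.exp (4 * M)) := by positivity
  have hb1 : 1 < b := by linarith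
  refine ⟨b, hb1, ?_⟩
  rintro θ₁ ⟨s1, B1⟩ θ₂ ⟨s2, B2⟩ z1 z2
  have c1 := series_cont s1
  have c2 := series_cont s2
  have b1 : ∀ t, |seriesFun θ₁ t| ≤ M := fun t => (series_bound s1 t).trans (by linarith)
  have b2 : ∀ t, |seriesFun θ₂ t| ≤ M := fun t => (series_bound s2 t).trans (by linarith)
  have l1 := logZ_bound c1 b1
  have l2 := logZ_bound c2 b2
  have hd : Summable fun j => |θ₁ j - θ₂ j| :=
    Summable.of_nonneg_of_le (fun _ => abs_nonneg _) (fun j => abs_sub _ _) (s1.add s2)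
  have hdiff : ∀ t, seriesFun (fun j => θ₁ j - θ₂ j) t = seriesFun θ₁ t - seriesFun θ₂ t := by
    intro t
    simp only [seriesFun, sub_mul]
    exact (term_summable s1 t).tsum_sub (term_summable s2 t)
  have hS : ∫ t, (seriesFun θ₁ t - seriesFun θ₂ t) ^ 2 ∂mu01 = l2sq θ₁ θ₂ := by
    have := series_parseval hd
    simp only [hdiff] at this
    exact this
  have hm : ∫ t, (seriesFun θ₁ t - seriesFun θ₂ t) ∂mu01 = 0 := by
    have := series_mean hd
    simp only [hdiff, z1, z2, sub_self] at this
    exact this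
  have hz := logZ_diff c1 c2 b1 b2
  rw [hS] at hz
  have D1 := density_eq s1
  have D2 := density_eq s2
  set f₁ := seriesFun θ₁ with hf1
  set f₂ := seriesFun θ₂ with hf2
  set S := l2sq θ₁ θ₂ with hSdef
  set k₁ := logZ f₁ with hk1
  set k₂ := logZ f₂ with hk2
  have n1 : ∫ t, Real.exp (f₁ t - k₁) ∂mu01 = 1 := by
    simp_rw [Real.exp_sub]
    rw [integral_div, hk1, exp_logZ c1 b1, div_self]
    exact (lt_of_lt_of_le (Real.exp_pos _) (Z_bounds c1 b1).1).ne'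
  have n2 : ∫ t, Real.exp (f₂ t - k₂) ∂mu01 = 1 := by
    simp_rw [Real.exp_sub]
    rw [integral_div, hk2, exp_logZ c2 b2, div_self]
    exact (lt_of_lt_of_le (Real.exp_pos _) (Z_bounds c2 b2).1).ne'
  have hW : ∫ t, ((f₁ t - k₁) - (f₂ t - k₂)) ^ 2 ∂mu01 = S + (k₁ - k₂) ^ 2 := by
    have e : ∀ t, ((f₁ t - k₁) - (f₂ t - k₂)) ^ 2
        = (f₁ t - f₂ t) ^ 2 - 2 * (k₁ - k₂) * (f₁ t - f₂ t) + (k₁ - k₂) ^ 2 := by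
      intro t; ring
    simp_rw [e]
    rw [integral_add (mu_integrable (by fun_prop)) (mu_integrable (by fun_prop)),
        integral_sub (mu_integrable (by fun_prop)) (mu_integrable (by fun_prop)),
        integral_const_mul, hm, hS]
    simp
  have hlog : ∀ t, Real.log (densityF θ₁ t / densityF θ₂ t) = (f₁ t - k₁) - (f₂ t - k₂) := by
    intro t
    rw [D1, D2, ← Real.exp_sub, Real.log_exp]
  have hKL : KLdiv θ₁ θ₂ = ∫ t, Real.exp (f₁ t - k₁) * ((f₁ t - k₁) - (f₂ t - k₂)) ∂mu01 := by
    simp only [KLdiv, hlog]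
    simp only [D1]
  have hV : Vdiv θ₁ θ₂ = ∫ t, Real.exp (f₁ t - k₁) * ((f₁ t - k₁) - (f₂ t - k₂)
      - ∫ t, Real.exp (f₁ t - k₁) * ((f₁ t - k₁) - (f₂ t - k₂)) ∂mu01) ^ 2 ∂mu01 := by
    simp only [Vdiv, hlog]
    simp only [D1, hKL]
  have hH : Hdist θ₁ θ₂ = √(∫ t, (Real.exp ((f₁ t - k₁) / 2) - Real.exp ((f₂ t - k₂) / 2)) ^ 2 ∂mu01) := by
    simp only [Hdist, D1, D2, Real.exp_half]
  have key := abstract_bounds (g₁ := fun t => f₁ t - k₁) (g₂ := fun t => f₂ t - k₂) (K := 2 * M)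
    (by fun_prop) (by fun_prop)
    (fun t => (abs_sub _ _).trans (by linarith [b1 t]))
    (fun t => (abs_sub _ _).trans (by linarith [b2 t])) n1 n2
  rw [← hKL] at key
  rw [← hKL] at hV
  rw [← hV, hW] at key
  obtain ⟨k1, k2, k3, k4⟩ := key
  have S0 : 0 ≤ S := tsum_nonneg fun j => sq_nonneg _
  have hmain : Real.exp (2 * M) * (S + (k₁ - k₂) ^ 2) ≤ b * S := by
    have h1 : Real.exp (2 * M) * (S + (k₁ - k₂) ^ 2)
        ≤ Real.exp (2 * M) * (S + Real.exp (4 * M) * S) := by gcongr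
    have h2 : 0 ≤ Real.exp (2 * M) * (1 + Real.exp (4 * M)) * S := by positivity
    rw [hb]; nlinarith
  have h4 : 4 * Real.exp (2 * M) ≤ b := by
    have : 0 < Real.exp (2 * M) * Real.exp (4 * M) := by positivity
    rw [hb]; nlinarith
  clear_value b
  have b0 : 0 ≤ b := by linarith
  have hbb : b ≤ b ^ 2 := by nlinarith
  refine ⟨k1.trans hmain, k2.trans hmain, ?_, ?_⟩
  · rw [inv_mul_le_iff₀ (by linarith), hH]
    apply Real.sqrt_le_iff.2
    refine ⟨mul_nonneg b0 (Real.sqrt_nonneg _), ?_⟩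
    rw [mul_pow, Real.sq_sqrt S0]
    exact (k3.trans hmain).trans (mul_le_mul_of_nonneg_right hbb S0)
  · rw [hH]
    apply Real.sqrt_le_iff.2
    refine ⟨mul_nonneg b0 (Real.sqrt_nonneg _), ?_⟩
    have I0 : 0 ≤ ∫ t, (Real.exp ((f₁ t - k₁) / 2) - Real.exp ((f₂ t - k₂) / 2)) ^ 2 ∂mu01 :=
      integral_nonneg fun t => sq_nonneg _
    rw [mul_pow, Real.sq_sqrt I0]
    calc S ≤ S + (k₁ - k₂) ^ 2 := by nlinarith [sq_nonneg (k₁ - k₂)]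
      _ ≤ _ := k4
      _ ≤ _ := mul_le_mul_of_nonneg_right (h4.trans hbb) I0

end
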